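/- arXiv:2410.20364 — 2 statements merged into one kernel-verified Lean document; each statement's English description precedes it below -/
import Mathlib

section
/- Let Q* be the uniform distribution on [0,1] and for θ ∈ [1/4, 3/4] let Q_θ have the tent-perturbed density f_θ(t) = 1/2 on [0, θ−1/4] ∪ [θ+1/4, 1], f_θ(t) = 8(t−θ+1/4) + 1/2 on [θ−1/4, θ], and f_θ(t) = −8(t−θ+1/4) + 9/2 on [θ, θ+1/4]. Then D_KL(Q* ‖ Q_θ) = ∫₀¹ ln(1/f_θ(t)) dt = 1/2 + ln 2 − (5/8) ln 5, independently of θ; hence the minimizer set argmin_{θ∈[1/4,3/4]} D_KL(Q*‖Q_θ) equals the whole interval [1/4, 3/4]. -/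
/-- The tent-perturbed density `f_θ` on `[0,1]`, for `θ ∈ [1/4, 3/4]`. -/
noncomputable def tentDensity (θ t : ℝ) : ℝ :=
  if t ≤ θ - 1/4 then 1/2
  else if t ≤ θ then 8 * (t - θ + 1/4) + 1/2
  else if t ≤ θ + 1/4 then -8 * (t - θ + 1/4) + 9/2
  else 1/2

theorem tentDensity_eq_max (θ t : ℝ) :
    tentDensity θ t = max (1/2) (5/2 - 8 * |t - θ|) := by
  unfold tentDensity
  split_ifs <;> rcases abs_cases (t - θ) with h | h <;> rw [h.1] <;>
    first
    | (rw [max_eq_left (by linarith)]; done)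
    | (rw [max_eq_right (by linarith)]; linarith)

theorem tentDensity_pos (θ t : ℝ) : 0 < tentDensity θ t := by
  rw [tentDensity_eq_max]
  exact lt_max_of_lt_left (by norm_num)

theorem continuous_log_one_div_tentDensity (θ : ℝ) :
    Continuous fun t => Real.log (1 / tentDensity θ t) := by
  have hf : Continuous (tentDensity θ) := by
    rw [funext (tentDensity_eq_max θ)]
    fun_prop
  exact (continuous_const.div hf fun t => (tentDensity_pos θ t).ne').log
    fun t => (one_div_pos.2 (tentDensity_pos θ t)).ne'

theorem integral_log_one_div_tentDensity_of_flat {θ a b : ℝ} (hab : a ≤ b)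
    (h : ∀ t ∈ Set.Icc a b, 1/4 ≤ |t - θ|) :
    ∫ t in a..b, Real.log (1 / tentDensity θ t) = (b - a) * Real.log 2 := by
  rw [← smul_eq_mul, ← intervalIntegral.integral_const]
  refine intervalIntegral.integral_congr fun t ht => ?_
  rw [Set.uIcc_of_le hab] at ht
  have := h t ht
  simp only [tentDensity_eq_max]
  rw [max_eq_left (by linarith)]
  norm_num

theorem integral_log_half_five_halves :
    ∫ s in (1/2 : ℝ)..(5/2), Real.log s = 5/2 * Real.log 5 - 2 * Real.log 2 - 2 := by
  rw [integral_log, Real.log_div (by norm_num) (by norm_num),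
    Real.log_div (by norm_num) (by norm_num), Real.log_one]
  ring

theorem integral_log_one_div_tentDensity_left (θ : ℝ) :
    ∫ t in (θ - 1/4)..θ, Real.log (1 / tentDensity θ t) =
      -(1/8) * (5/2 * Real.log 5 - 2 * Real.log 2 - 2) := by
  have h : Set.EqOn (fun t => Real.log (1 / tentDensity θ t))
      (fun t => -Real.log (8 * t + (5/2 - 8 * θ))) (Set.uIcc (θ - 1/4) θ) := by
    intro t ht
    rw [Set.uIcc_of_le (by linarith)] at ht
    simp only [tentDensity_eq_max]
    rw [abs_of_nonpos (by linarith [ht.2]), max_eq_right (by linarith [ht.1]), one_div,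
      Real.log_inv]
    ring_nf
  rw [intervalIntegral.integral_congr h, intervalIntegral.integral_neg,
    intervalIntegral.integral_comp_mul_add (fun s => Real.log s) (by norm_num),
    ← integral_log_half_five_halves, smul_eq_mul]
  ring_nf

theorem integral_log_one_div_tentDensity_right (θ : ℝ) :
    ∫ t in θ..(θ + 1/4), Real.log (1 / tentDensity θ t) =
      -(1/8) * (5/2 * Real.log 5 - 2 * Real.log 2 - 2) := by
  have h : Set.EqOn (fun t => Real.log (1 / tentDensity θ t))
      (fun t => -Real.log ((5/2 + 8 * θ) - 8 * t)) (Set.uIcc θ (θ + 1/4)) := by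
    intro t ht
    rw [Set.uIcc_of_le (by linarith)] at ht
    simp only [tentDensity_eq_max]
    rw [abs_of_nonneg (by linarith [ht.1]), max_eq_right (by linarith [ht.2]), one_div,
      Real.log_inv]
    ring_nf
  rw [intervalIntegral.integral_congr h, intervalIntegral.integral_neg,
    intervalIntegral.integral_comp_sub_mul (fun s => Real.log s) (by norm_num),
    ← integral_log_half_five_halves, smul_eq_mul]
  ring_nf

theorem integral_log_one_div_tentDensity {θ : ℝ} (hθ : θ ∈ Set.Icc (1/4 : ℝ) (3/4)) :
    ∫ t in (0:ℝ)..1, Real.log (1 / tentDensity θ t) =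
      1/2 + Real.log 2 - 5/8 * Real.log 5 := by
  have hi (a b : ℝ) := (continuous_log_one_div_tentDensity θ).intervalIntegrable
    (μ := MeasureTheory.volume) a b
  rw [← intervalIntegral.integral_add_adjacent_intervals (hi 0 (θ - 1/4)) (hi _ 1),
    ← intervalIntegral.integral_add_adjacent_intervals (hi (θ - 1/4) θ) (hi _ 1),
    ← intervalIntegral.integral_add_adjacent_intervals (hi θ (θ + 1/4)) (hi _ 1),
    integral_log_one_div_tentDensity_left, integral_log_one_div_tentDensity_right,
    integral_log_one_div_tentDensity_of_flat (by linarith [hθ.1])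
      fun t ht => le_abs.2 (Or.inr (by linarith [ht.2])),
    integral_log_one_div_tentDensity_of_flat (by linarith [hθ.2])
      fun t ht => le_abs.2 (Or.inl (by linarith [ht.1]))]
  ring

/-- `D_KL(Q*‖Q_θ) = ∫₀¹ ln(1/f_θ) = 1/2 + ln 2 − (5/8) ln 5` for
every `θ ∈ [1/4, 3/4]`, so the argmin set is the whole interval. -/
theorem tent_kl_constant_and_argmin :
    (∀ θ ∈ Set.Icc (1/4 : ℝ) (3/4),
      ∫ t in (0:ℝ)..1, Real.log (1 / tentDensity θ t) =
        1/2 + Real.log 2 - 5/8 * Real.log 5) ∧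
    {θ ∈ Set.Icc (1/4 : ℝ) (3/4) |
        ∀ θ' ∈ Set.Icc (1/4 : ℝ) (3/4),
          (∫ t in (0:ℝ)..1, Real.log (1 / tentDensity θ t)) ≤
          ∫ t in (0:ℝ)..1, Real.log (1 / tentDensity θ' t)} =
      Set.Icc (1/4 : ℝ) (3/4) := by
  refine ⟨fun θ hθ => integral_log_one_div_tentDensity hθ, ?_⟩
  refine Set.Subset.antisymm (fun θ hθ => hθ.1) fun θ hθ => ⟨hθ, fun θ' hθ' => ?_⟩
  rw [integral_log_one_div_tentDensity hθ, integral_log_one_div_tentDensity hθ']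
end

section
/- Suppose for each j = 1,…,n, X_j ⊆ ℝ^{n_j} is nonempty, convex, and compact, and ϑ_j : X_j × X_{−j} → ℝ is continuous and concave in its first argument for each fixed x_{−j}. Then there exists a Nash equilibrium: an x* ∈ X with x*_j ∈ argmax_{x_j ∈ X_j} ϑ_j(x_j, x*_{−j}) for every j. -/
/-- A set `S` is dominant for a family of rankings `r` if no element outranks, for every ranking
simultaneously, the lowest element of `S`. -/
def IsDominant {ι V : Type*} (r : ι → V → ℕ) (S : Finset V) : Prop :=
  ∀ y, ∃ i, ∀ s ∈ S, r i y ≤ r i s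

namespace IsDominant

variable {ι V : Type*} {r : ι → V → ℕ} {S D : Finset V}

lemma mono (hS : IsDominant r S) (h : D ⊆ S) : IsDominant r D := fun y =>
  (hS y).imp fun _ hi s hs => hi s (h hs)

/-- Inserting `y` in a dominant set `D` gives a dominant set if `y` is ranked as high as possible by
`r i` among the elements that lie above the lowest element of `D` in every other ranking. -/
lemma insert_of_isMax [DecidableEq V] (hD : IsDominant r D) {a : ι → V}
    (ha : ∀ k, a k ∈ D) (hmin : ∀ k, ∀ s ∈ D, r k (a k) ≤ r k s) {i : ι} {y : V}
    (hy : ∀ k ≠ i, r k (a k) < r k y)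
    (hmax : ∀ z, (∀ k ≠ i, r k (a k) < r k z) → r i z ≤ r i y) :
    IsDominant r (insert y D) := by
  intro z
  by_cases hz : ∀ k ≠ i, r k (a k) < r k z
  · obtain ⟨k, hk⟩ := hD z
    have hki : k = i := by
      by_contra hki
      exact absurd (hk _ (ha k)) (not_le.2 (hz k hki))
    subst hki
    exact ⟨k, by simpa using ⟨hmax z hz, hk⟩⟩
  · push Not at hz
    obtain ⟨k, hki, hk⟩ := hz
    refine ⟨k, ?_⟩
    simp only [Finset.mem_insert, forall_eq_or_imp]
    exact ⟨hk.trans (hy k hki).le, fun s hs => hk.trans (hmin k s hs)⟩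

/-- In a dominant set with one element less than there are rankings, every element is lowest for
some ranking, and exactly two rankings share their lowest element. -/
lemma exists_pair [Fintype ι] (hr : ∀ i, Function.Injective (r i))
    (hD : IsDominant r D) (hne : D.Nonempty) (hcard : D.card + 1 = Fintype.card ι) :
    ∃ a : ι → V, (∀ k, a k ∈ D) ∧ (∀ k, ∀ s ∈ D, r k (a k) ≤ r k s) ∧
      (∀ s ∈ D, ∃ k, a k = s) ∧
      ∃ i j, i ≠ j ∧ a i = a j ∧ Set.InjOn a {k | k ≠ i} ∧ Set.InjOn a {k | k ≠ j} := by
  classical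
  choose a ha hmin using fun k => Finset.exists_min_image D (r k) hne
  have hsurj : ∀ s ∈ D, ∃ k, a k = s := fun s hs =>
    (hD s).imp fun k hk => hr k (le_antisymm (hmin k s hs) (hk _ (ha k)))
  obtain ⟨i, -, j, -, hij, haij⟩ := Finset.exists_ne_map_eq_of_card_lt_of_maps_to
    (s := Finset.univ) (t := D) (f := a) (by rw [Finset.card_univ]; omega) (fun k _ => ha k)
  have key : ∀ i j, i ≠ j → a i = a j → Set.InjOn a {k | k ≠ i} := by
    intro i j hij haij
    have himg : (Finset.univ.erase i).image a = D := by
      ext s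
      simp only [Finset.mem_image, Finset.mem_erase, Finset.mem_univ, and_true]
      refine ⟨fun ⟨k, _, hk⟩ => hk ▸ ha k, fun hs => ?_⟩
      obtain ⟨k, rfl⟩ := hsurj s hs
      by_cases hk : k = i
      · exact ⟨j, hij.symm, by rw [hk, haij]⟩
      · exact ⟨k, hk, rfl⟩
    have hinj : Set.InjOn a (Finset.univ.erase i : Finset ι) := by
      apply Finset.injOn_of_card_image_eq
      rw [himg, Finset.card_erase_of_mem (Finset.mem_univ i), Finset.card_univ]
      omega
    intro k hk l hl
    exact hinj (by simpa using hk) (by simpa using hl)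
  exact ⟨a, ha, hmin, hsurj, i, j, hij, haij, key i j hij haij, key j i hij.symm haij.symm⟩

/-- If inserting `y` in a dominant set with one element less than there are rankings keeps it
dominant, then `y` lies above the lowest element in all rankings but one of the exceptional pair. -/
lemma lt_of_insert [DecidableEq V] (hr : ∀ i, Function.Injective (r i)) {a : ι → V}
    (ha : ∀ k, a k ∈ D) (hmin : ∀ k, ∀ s ∈ D, r k (a k) ≤ r k s) {i j : ι} (hij : i ≠ j)
    (haij : a i = a j) (hi : Set.InjOn a {k | k ≠ i}) (hj : Set.InjOn a {k | k ≠ j}) {y : V}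
    (hyD : y ∉ D) (hy : IsDominant r (insert y D)) :
    (∀ k ≠ i, r k (a k) < r k y) ∨ (∀ k ≠ j, r k (a k) < r k y) := by
  have hlt : ∀ k, r k (a k) ≤ r k y → r k (a k) < r k y := fun k hk =>
    lt_of_le_of_ne hk fun h => hyD (hr k h ▸ ha k)
  have hlow : ∀ s ∈ D, ∃ k, a k = s ∧ r k (a k) < r k y := by
    intro s hs
    obtain ⟨k, hk⟩ := hy s
    have hks : a k = s := hr k (le_antisymm (hmin k s hs) (hk _ (Finset.mem_insert_of_mem (ha k))))
    exact ⟨k, hks, hlt k (hks ▸ hk y (Finset.mem_insert_self y D))⟩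
  have hother : ∀ k, k ≠ i → k ≠ j → r k (a k) < r k y := by
    intro k hki hkj
    obtain ⟨l, hl, hly⟩ := hlow _ (ha k)
    by_cases hli : l = i
    · subst hli
      exact absurd (hj hij hkj hl) hki.symm
    · exact hi hli hki hl ▸ hly
  obtain ⟨l, hl, hly⟩ := hlow _ (ha i)
  by_cases hli : l = i
  · subst hli
    refine Or.inr fun k hk => ?_
    by_cases hkl : k = l
    · exact hkl ▸ hly
    · exact hother k hkl hk
  · have hlj : l = j := hi hli hij.symm (hl.trans haij)
    subst hlj
    refine Or.inl fun k hk => ?_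
    by_cases hkl : k = l
    · exact hkl ▸ hly
    · exact hother k hk hkl

/-- A nonempty set with one element less than there are rankings extends to an even number of
dominant sets with one more element. -/
lemma even_card_insert [Fintype ι] [Fintype V] [DecidableEq V]
    [DecidablePred fun S : Finset V => IsDominant r S]
    (hr : ∀ i, Function.Injective (r i)) (hne : D.Nonempty) (hcard : D.card + 1 = Fintype.card ι)
    (hext : ∀ i, ∃ y, ∀ k ≠ i, ∃ s ∈ D, r k s < r k y) :
    Even (Finset.univ.filter fun y => y ∉ D ∧ IsDominant r (insert y D)).card := by
  classical
  by_cases hD : IsDominant r D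
  swap
  · rw [Finset.filter_false_of_mem fun y _ h => hD (h.2.mono (Finset.subset_insert y D))]
    simp
  obtain ⟨a, ha, hmin, hsurj, i, j, hij, haij, hi, hj⟩ := hD.exists_pair hr hne hcard
  have hmax : ∀ i, ∃ y, (∀ k ≠ i, r k (a k) < r k y) ∧
      ∀ z, (∀ k ≠ i, r k (a k) < r k z) → r i z ≤ r i y := by
    intro i
    obtain ⟨y, hy⟩ := hext i
    obtain ⟨z, hz, hzmax⟩ := Finset.exists_max_image
      (Finset.univ.filter fun y => ∀ k ≠ i, r k (a k) < r k y) (r i) ⟨y, by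
        simp only [Finset.mem_filter, Finset.mem_univ, true_and]
        intro k hk
        obtain ⟨s, hs, hsy⟩ := hy k hk
        exact (hmin k s hs).trans_lt hsy⟩
    exact ⟨z, by simpa using hz, fun w hw => hzmax w (by simpa using hw)⟩
  have hnotMem : ∀ i j, i ≠ j → a i = a j → ∀ y, (∀ k ≠ i, r k (a k) < r k y) → y ∉ D := by
    intro i j hij haij y hy hyD
    obtain ⟨k, rfl⟩ := hsurj y hyD
    by_cases hk : k = i
    · subst hk
      exact (hy j hij.symm).ne (by rw [haij])
    · exact (hy k hk).ne rfl
  have huniq : ∀ i y z, (∀ k ≠ i, r k (a k) < r k z) →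
      (∀ z, (∀ k ≠ i, r k (a k) < r k z) → r i z ≤ r i y) →
      (∀ k ≠ i, r k (a k) < r k y) → IsDominant r (insert z D) → z = y := by
    intro i y z hz hy hyi hdom
    refine hr i (le_antisymm (hy z hz) ?_)
    obtain ⟨k, hk⟩ := hdom y
    by_cases hki : k = i
    · exact hki ▸ hk z (Finset.mem_insert_self z D)
    · exact absurd (hk _ (Finset.mem_insert_of_mem (ha k))) (not_le.2 (hyi k hki))
  obtain ⟨y, hy, hymax⟩ := hmax i
  obtain ⟨z, hz, hzmax⟩ := hmax j
  have hyz : y ≠ z := by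
    rintro rfl
    obtain ⟨k, hk⟩ := hD y
    refine absurd (hk _ (ha k)) (not_le.2 ?_)
    by_cases hki : k = i
    · exact hz k (hki ▸ hij)
    · exact hy k hki
  have hset : (Finset.univ.filter fun y => y ∉ D ∧ IsDominant r (insert y D)) = {y, z} := by
    ext w
    simp only [Finset.mem_filter, Finset.mem_univ, true_and, Finset.mem_insert,
      Finset.mem_singleton]
    constructor
    · rintro ⟨hwD, hw⟩
      exact (lt_of_insert hr ha hmin hij haij hi hj hwD hw).imp
        (fun h => huniq i y w h hymax hy hw) (fun h => huniq j z w h hzmax hz hw)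
    · rintro (rfl | rfl)
      · exact ⟨hnotMem i j hij haij w hy, hD.insert_of_isMax ha hmin hy hymax⟩
      · exact ⟨hnotMem j i hij.symm haij.symm w hz, hD.insert_of_isMax ha hmin hz hzmax⟩
  rw [hset, Finset.card_pair hyz]
  exact even_two

end IsDominant

/-- A set with as many elements as there are colours, but not of all colours, has an even number of
elements whose removal leaves exactly the colours other than `l`. -/
lemma Finset.even_card_filter_image_erase {ι V : Type*} [Fintype ι] [DecidableEq ι] [DecidableEq V]
    {R : Finset V} {c : V → ι} {l : ι} (hcard : R.card = Fintype.card ι)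
    (hc : R.image c ≠ Finset.univ) :
    Even (R.filter fun x => (R.erase x).image c = Finset.univ.erase l).card := by
  by_cases h : ∃ x ∈ R, (R.erase x).image c = Finset.univ.erase l
  swap
  · push Not at h
    rw [Finset.filter_false_of_mem h]
    simp
  obtain ⟨x, hx, hxl⟩ := h
  have hinj : Set.InjOn c (R.erase x : Finset V) := by
    apply Finset.injOn_of_card_image_eq
    rw [hxl, Finset.card_erase_of_mem hx, Finset.card_erase_of_mem (Finset.mem_univ l),
      Finset.card_univ, hcard]
  have himg : R.image c = insert (c x) (Finset.univ.erase l) := by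
    rw [← hxl, ← Finset.image_insert, Finset.insert_erase hx]
  have hxc : c x ≠ l := by
    rintro rfl
    exact hc (by rw [himg, Finset.insert_erase (Finset.mem_univ _)])
  obtain ⟨y, hy, hyx⟩ : ∃ y ∈ R.erase x, c y = c x := by
    have : c x ∈ (R.erase x).image c := by rw [hxl]; simp [hxc]
    simpa using this
  obtain ⟨hyne, hyR⟩ := Finset.mem_erase.1 hy
  have hset : (R.filter fun x => (R.erase x).image c = Finset.univ.erase l) = {x, y} := by
    ext w
    simp only [Finset.mem_filter, Finset.mem_insert, Finset.mem_singleton]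
    constructor
    · rintro ⟨hw, hwl⟩
      by_contra! hne
      have hcw : c w ∈ (R.erase w).image c := by
        have : c w ∈ (R.erase x).image c :=
          Finset.mem_image_of_mem c (Finset.mem_erase.2 ⟨hne.1, hw⟩)
        rwa [hxl, ← hwl] at this
      obtain ⟨v, hv, hvw⟩ := Finset.mem_image.1 hcw
      obtain ⟨hvne, hvR⟩ := Finset.mem_erase.1 hv
      by_cases hvx : v = x
      · subst hvx
        exact hne.2 (hinj (by simp [hne.1, hw]) (by simp [hyne, hyR]) (hvw.symm.trans hyx.symm))
      · exact hvne (hinj (by simp [hvx, hvR]) (by simp [hne.1, hw]) hvw)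
    · rintro (rfl | rfl)
      · exact ⟨hx, hxl⟩
      · refine ⟨hyR, ?_⟩
        rw [← hxl]
        ext k
        simp only [Finset.mem_image, Finset.mem_erase]
        constructor
        · rintro ⟨v, ⟨hv, hvR⟩, rfl⟩
          by_cases hvx : v = x
          · exact ⟨w, ⟨hyne, hyR⟩, by rw [hyx, hvx]⟩
          · exact ⟨v, ⟨hvx, hvR⟩, rfl⟩
        · rintro ⟨v, ⟨hv, hvR⟩, rfl⟩
          by_cases hvw : v = w
          · exact ⟨x, ⟨hyne.symm, hx⟩, by rw [hvw, hyx]⟩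
          · exact ⟨v, ⟨hvw, hvR⟩, rfl⟩
  rw [hset, Finset.card_pair hyne.symm]
  exact even_two

section Scarf

variable {ι T : Type*} [Fintype ι] [Fintype T] [DecidableEq ι] [DecidableEq T]
  {r : ι → T ⊕ ι → ℕ}

lemma even_card_insert_of_inl_mem [DecidablePred fun S : Finset (T ⊕ ι) => IsDominant r S]
    (hr : ∀ i, Function.Injective (r i))
    (hhigh : ∀ i j t, j ≠ i → r i (Sum.inl t) < r i (Sum.inr j))
    {D : Finset (T ⊕ ι)} (hcard : D.card + 1 = Fintype.card ι) {t : T} (ht : Sum.inl t ∈ D) :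
    Even (Finset.univ.filter fun y => y ∉ D ∧ IsDominant r (insert y D)).card := by
  refine IsDominant.even_card_insert hr ⟨_, ht⟩ hcard fun i => ?_
  exact ⟨Sum.inr i, fun k hk => ⟨_, ht, hhigh k i t hk.symm⟩⟩

lemma card_insert_image_inr [DecidablePred fun S : Finset (T ⊕ ι) => IsDominant r S] [Nonempty T]
    (hr : ∀ i, Function.Injective (r i))
    (hlow : ∀ i v, v ≠ Sum.inr i → r i (Sum.inr i) < r i v)
    (hhigh : ∀ i j t, j ≠ i → r i (Sum.inl t) < r i (Sum.inr j)) (l : ι) :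
    (Finset.univ.filter fun y : T ⊕ ι => y ∉ (Finset.univ.erase l).image Sum.inr ∧
      IsDominant r (insert y ((Finset.univ.erase l).image Sum.inr))).card = 1 := by
  obtain ⟨t, -, ht⟩ := Finset.exists_max_image (Finset.univ : Finset T)
    (fun t => r l (Sum.inl t)) Finset.univ_nonempty
  rw [Finset.card_eq_one]
  refine ⟨Sum.inl t, ?_⟩
  ext y
  simp only [Finset.mem_filter, Finset.mem_univ, true_and, Finset.mem_singleton, Finset.mem_image,
    Finset.mem_erase, and_true, IsDominant, Finset.mem_insert, forall_eq_or_imp]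
  constructor
  · rintro ⟨hy, hdom⟩
    obtain ⟨k, hk, hkD⟩ := hdom (Sum.inl t)
    have hkl : k = l := by
      by_contra hkl
      exact absurd (hkD _ ⟨k, hkl, rfl⟩) (not_le.2 (hlow k _ (by simp)))
    subst hkl
    rcases y with u | j
    · exact hr k (le_antisymm (ht u (Finset.mem_univ u)) hk)
    · by_cases hj : j = k
      · subst hj
        exact absurd hk (not_le.2 (hlow j _ (by simp)))
      · exact absurd ⟨j, hj, rfl⟩ hy
  · rintro rfl
    refine ⟨by simp, ?_⟩
    rintro (u | j)
    · refine ⟨l, ht u (Finset.mem_univ u), ?_⟩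
      rintro _ ⟨j, hj, rfl⟩
      exact (hhigh l j u hj).le
    · have hle : ∀ v, r j (Sum.inr j) ≤ r j v := fun v => by
        by_cases hv : v = Sum.inr j
        · rw [hv]
        · exact (hlow j v hv).le
      exact ⟨j, hle _, fun v _ => hle v⟩

/-- **Scarf's lemma**, for rankings extended by slack elements `Sum.inr i`: the slack element `i` is
lowest in ranking `i` and above all proper elements in the other rankings. -/
lemma exists_isDominant_image_eq_univ [Nonempty ι] [Nonempty T]
    (hr : ∀ i, Function.Injective (r i))
    (hlow : ∀ i v, v ≠ Sum.inr i → r i (Sum.inr i) < r i v)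
    (hhigh : ∀ i j t, j ≠ i → r i (Sum.inl t) < r i (Sum.inr j)) (c : T → ι) :
    ∃ R, IsDominant r R ∧ R.image (Sum.elim c id) = Finset.univ := by
  classical
  by_contra! hno
  obtain ⟨l⟩ := ‹Nonempty ι›
  set c' : T ⊕ ι → ι := Sum.elim c id
  set P : Finset (Finset (T ⊕ ι) × (T ⊕ ι)) := Finset.univ.filter fun p =>
    p.2 ∈ p.1 ∧ p.1.card = Fintype.card ι ∧ IsDominant r p.1 ∧
      (p.1.erase p.2).image c' = Finset.univ.erase l with hP
  have heven : Even P.card := by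
    rw [Finset.card_eq_sum_card_fiberwise (f := Prod.fst) (t := Finset.univ) (by simp)]
    refine Finset.even_sum _ fun R _ => ?_
    by_cases hR : R.card = Fintype.card ι ∧ IsDominant r R
    · suffices hcard : (P.filter fun p => p.1 = R).card =
          (R.filter fun x => (R.erase x).image c' = Finset.univ.erase l).card by
        rw [hcard]
        exact Finset.even_card_filter_image_erase hR.1 (hno R hR.2)
      refine Finset.card_nbij' Prod.snd (fun x => (R, x)) ?_ ?_ ?_ ?_
      · rintro ⟨S, x⟩ h
        simp only [hP, Finset.coe_filter, Finset.mem_filter, Finset.mem_univ, true_and,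
          Set.mem_ofPred_eq] at h ⊢
        obtain ⟨⟨h1, -, -, h2⟩, rfl⟩ := h
        exact ⟨h1, h2⟩
      · intro x h
        simp only [hP, Finset.coe_filter, Finset.mem_filter, Finset.mem_univ, true_and,
          Set.mem_ofPred_eq] at h ⊢
        exact ⟨⟨h.1, hR.1, hR.2, h.2⟩, trivial⟩
      · rintro ⟨S, x⟩ h
        simp only [Finset.coe_filter, Set.mem_ofPred_eq] at h
        rw [← h.2]
      · intro x _
        rfl
    · rw [Finset.filter_false_of_mem]
      · simp
      · rintro ⟨S, x⟩ h rfl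
        simp only [hP, Finset.mem_filter, Finset.mem_univ, true_and] at h
        exact hR ⟨h.2.1, h.2.2.1⟩
  have hfiber : ∀ D : Finset (T ⊕ ι), D.card + 1 = Fintype.card ι →
      D.image c' = Finset.univ.erase l → (P.filter fun p => p.1.erase p.2 = D).card =
        (Finset.univ.filter fun y => y ∉ D ∧ IsDominant r (insert y D)).card := by
    intro D hD hDl
    refine Finset.card_nbij' Prod.snd (fun y => (insert y D, y)) ?_ ?_ ?_ ?_
    · rintro ⟨S, x⟩ h
      simp only [hP, Finset.coe_filter, Finset.mem_filter, Finset.mem_univ, true_and,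
        Set.mem_ofPred_eq] at h ⊢
      obtain ⟨⟨h1, -, h2, -⟩, rfl⟩ := h
      exact ⟨Finset.notMem_erase x S, by rwa [Finset.insert_erase h1]⟩
    · intro x h
      simp only [hP, Finset.coe_filter, Finset.mem_filter, Finset.mem_univ, true_and,
        Set.mem_ofPred_eq] at h ⊢
      rw [Finset.erase_insert h.1, Finset.card_insert_of_notMem h.1]
      exact ⟨⟨Finset.mem_insert_self x D, hD, h.2, hDl⟩, rfl⟩
    · rintro ⟨S, x⟩ h
      simp only [hP, Finset.coe_filter, Finset.mem_filter, Finset.mem_univ, true_and,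
        Set.mem_ofPred_eq] at h ⊢
      obtain ⟨⟨h1, -⟩, rfl⟩ := h
      rw [Finset.insert_erase h1]
    · intro x _
      rfl
  have hodd : Odd P.card := by
    rw [Finset.card_eq_sum_card_fiberwise (f := fun p => p.1.erase p.2) (t := Finset.univ)
      (by simp), ← Finset.add_sum_erase _ _
        (Finset.mem_univ ((Finset.univ.erase l).image (Sum.inr : ι → T ⊕ ι)))]
    refine Odd.add_even ?_ (Finset.even_sum _ fun D hD => ?_)
    · rw [hfiber, card_insert_image_inr hr hlow hhigh]
      · exact odd_one
      · rw [Finset.card_image_of_injective _ Sum.inr_injective,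
          Finset.card_erase_add_one (Finset.mem_univ l), Finset.card_univ]
      · rw [Finset.image_image]
        exact Finset.image_id
    · by_cases hDl : D.card + 1 = Fintype.card ι ∧ D.image c' = Finset.univ.erase l
      · rw [hfiber D hDl.1 hDl.2]
        obtain ⟨t, ht⟩ : ∃ t, Sum.inl t ∈ D := by
          by_contra! hinr
          refine Finset.ne_of_mem_erase hD ?_
          have hD' : ∀ v ∈ D, Sum.inr (c' v) = v := by
            rintro (t | j) hv
            · exact absurd hv (hinr t)
            · rfl
          rw [← hDl.2, Finset.image_image]
          conv_lhs => rw [← Finset.image_id (s := D)]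
          exact Finset.image_congr fun v hv => (hD' v hv).symm
        exact even_card_insert_of_inl_mem hr hhigh hDl.1 ht
      · rw [Finset.filter_false_of_mem]
        · simp
        · rintro ⟨S, x⟩ h rfl
          simp only [hP, Finset.mem_filter, Finset.mem_univ, true_and] at h
          refine hDl ⟨?_, h.2.2.2⟩
          rw [Finset.card_erase_add_one h.1, h.2.1]
  exact (Nat.not_even_iff_odd.2 hodd) heven

/-- **Scarf's lemma**: for every family of weak rankings of a finite set and every colouring of the
set by the rankings, some subset is dominant with respect to the rankings it is coloured by. -/
theorem exists_finset_forall_exists_le [Nonempty ι] [Nonempty T] (r : ι → T → ℕ) (c : T → ι) :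
    ∃ σ : Finset T, ∀ y, ∃ x ∈ σ, ∀ s ∈ σ, r (c x) y ≤ r (c x) s := by
  set e := Fintype.equivFin T
  set K := Fintype.card T
  set q : ι → T → ℕ := fun i t => r i t * K + e t with hq
  have hqr : ∀ i s t, q i s ≤ q i t → r i s ≤ r i t := by
    intro i s t h
    by_contra! hlt
    have h1 : (r i t + 1) * K ≤ r i s * K := Nat.mul_le_mul_right K hlt
    have h2 := (e t).isLt
    simp only [hq] at h
    rw [add_mul, one_mul] at h1
    omega
  have hqinj : ∀ i, Function.Injective (q i) := by
    intro i s t h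
    have h1 := le_antisymm (hqr i s t h.le) (hqr i t s h.ge)
    simp only [hq, h1, add_right_inj] at h
    exact e.injective (Fin.ext h)
  set B := ∑ i, ∑ t, q i t
  have hqB : ∀ i t, q i t ≤ B := fun i t =>
    (Finset.single_le_sum (f := q i) (fun _ _ => Nat.zero_le _) (Finset.mem_univ t)).trans
      (Finset.single_le_sum (f := fun i => ∑ t, q i t) (fun _ _ => Nat.zero_le _)
        (Finset.mem_univ i))
  set d := Fintype.equivFin ι
  set r' : ι → T ⊕ ι → ℕ := fun i =>
    Sum.elim (fun t => q i t + 1) (fun j => if j = i then 0 else B + 2 + d j) with hr'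
  obtain ⟨R, hR, hRc⟩ : ∃ R, IsDominant r' R ∧ R.image (Sum.elim c id) = Finset.univ := by
    refine exists_isDominant_image_eq_univ ?_ ?_ ?_ c
    · rintro i (s | j) (t | k) h
      · simp only [hr', Sum.elim_inl, add_left_inj] at h
        rw [hqinj i h]
      · have := hqB i s
        simp only [hr', Sum.elim_inl, Sum.elim_inr] at h
        split_ifs at h
        omega
      · have := hqB i t
        simp only [hr', Sum.elim_inl, Sum.elim_inr] at h
        split_ifs at h
        omega
      · simp only [hr', Sum.elim_inr] at h
        split_ifs at h with h1 h2 h2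
        · rw [h1, h2]
        · omega
        · omega
        · exact congrArg Sum.inr (d.injective (Fin.ext (by omega)))
    · rintro i (t | j) hv
      · simp [hr']
      · have hj : j ≠ i := fun h => hv (by rw [h])
        simp [hr', hj]
    · intro i j t hj
      have := hqB i t
      simp only [hr', Sum.elim_inl, Sum.elim_inr, if_neg hj]
      omega
  refine ⟨Finset.univ.filter fun t => Sum.inl t ∈ R, fun y => ?_⟩
  obtain ⟨i, hi⟩ := hR (Sum.inl y)
  have hiR : i ∈ R.image (Sum.elim c id) := hRc ▸ Finset.mem_univ i
  obtain ⟨x | j, hx, hxi⟩ := Finset.mem_image.1 hiR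
  · refine ⟨x, by simpa using hx, fun s hs => hqr _ _ _ ?_⟩
    have := hi (Sum.inl s) (by simpa using hs)
    simp only [Sum.elim_inl] at hxi
    simpa [hr', hxi] using this
  · simp only [Sum.elim_inr, id_eq] at hxi
    subst hxi
    have := hi _ hx
    simp [hr'] at this

end Scarf

section Brouwer

variable {ι : Type*} [Fintype ι]

/-- Scarf's lemma for the integer points of a dilated simplex: in every colouring there are points
of all colours, up to points close to a face, near some point. -/
lemma exists_nat_approx_of_coloring [Nonempty ι] (N : ℕ) (c : (ι → ℕ) → ι) :
    ∃ p : ι → ℕ, ∑ k, p k = N ∧ ∀ i, ∃ q : ι → ℕ, ∑ k, q k = N ∧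
      (∀ k, p k ≤ q k + Fintype.card ι ∧ q k ≤ p k + Fintype.card ι) ∧
      (c q = i ∨ q i ≤ Fintype.card ι) := by
  classical
  have hmem : ∀ t : ι → ℕ, t ∈ Finset.piAntidiag Finset.univ N ↔ ∑ k, t k = N := by
    simp [Finset.mem_piAntidiag]
  have i₀ : ι := Classical.arbitrary ι
  have : Nonempty (Finset.piAntidiag (Finset.univ : Finset ι) N) :=
    ⟨⟨Pi.single i₀ N, (hmem _).2 (by simp)⟩⟩
  obtain ⟨σ, hσ⟩ := exists_finset_forall_exists_le
    (fun i (t : Finset.piAntidiag (Finset.univ : Finset ι) N) => t.1 i) (fun t => c t.1)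
  obtain ⟨p, hp, -⟩ := hσ (Classical.arbitrary _)
  have hsum : ∀ t : Finset.piAntidiag (Finset.univ : Finset ι) N, ∑ k, t.1 k = N :=
    fun t => (hmem _).1 t.2
  choose b hbσ hb using fun i => Finset.exists_min_image σ (fun t => t.1 i) ⟨p, hp⟩
  set m : ι → ℕ := fun i => (b i).1 i
  set C : Finset ι := σ.image fun t => c t.1
  have hpC : c p.1 ∈ C := Finset.mem_image_of_mem _ hp
  have hC : N < ∑ i ∈ C, (m i + 1) := by
    by_contra! hle
    set y : ι → ℕ := fun i => (if i ∈ C then m i + 1 else 0) +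
      if i = c p.1 then N - ∑ i ∈ C, (m i + 1) else 0 with hy
    have hysum : ∑ i, y i = N := by
      simp only [hy, Finset.sum_add_distrib, Finset.sum_ite_eq', Finset.mem_univ, if_true,
        Finset.sum_ite_mem, Finset.univ_inter]
      rw [Finset.sum_add_distrib] at hle
      omega
    obtain ⟨x, hx, hxy⟩ := hσ ⟨y, (hmem y).2 hysum⟩
    have h1 := hxy _ (hbσ (c x.1))
    have h2 : c x.1 ∈ C := Finset.mem_image_of_mem _ hx
    simp only [hy, if_pos h2] at h1
    change m (c x.1) + 1 + _ ≤ m (c x.1) at h1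
    omega
  have hC' : N < ∑ i ∈ C, m i + Fintype.card ι := by
    rw [Finset.sum_add_distrib, Finset.sum_const, smul_eq_mul, mul_one] at hC
    exact hC.trans_le (Nat.add_le_add_left (Finset.card_le_univ C) _)
  have hnotin : ∀ s ∈ σ, ∀ i ∉ C, s.1 i ≤ Fintype.card ι := by
    intro s hs i hi
    have h1 : ∑ k ∈ insert i C, s.1 k ≤ N :=
      (Finset.sum_le_sum_of_subset (Finset.subset_univ _)).trans (hsum s).le
    rw [Finset.sum_insert hi] at h1
    have h2 : ∑ k ∈ C, m k ≤ ∑ k ∈ C, s.1 k := Finset.sum_le_sum fun k _ => hb k s hs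
    omega
  have hin : ∀ s ∈ σ, ∀ i ∈ C, s.1 i ≤ m i + Fintype.card ι := by
    intro s hs i hi
    have h1 : ∑ k ∈ C, s.1 k ≤ N :=
      (Finset.sum_le_sum_of_subset (Finset.subset_univ _)).trans (hsum s).le
    rw [← Finset.add_sum_erase _ _ hi] at h1 hC'
    have h2 : ∑ k ∈ C.erase i, m k ≤ ∑ k ∈ C.erase i, s.1 k :=
      Finset.sum_le_sum fun k _ => hb k s hs
    omega
  have hclose : ∀ s ∈ σ, ∀ t ∈ σ, ∀ k, s.1 k ≤ t.1 k + Fintype.card ι := by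
    intro s hs t ht k
    by_cases hk : k ∈ C
    · exact (hin s hs k hk).trans (Nat.add_le_add_right (hb k t ht) _)
    · exact (hnotin s hs k hk).trans (Nat.le_add_left _ _)
  refine ⟨p.1, hsum p, fun i => ?_⟩
  by_cases hi : i ∈ C
  · obtain ⟨q, hq, hqi⟩ := Finset.mem_image.1 hi
    exact ⟨q.1, hsum q, fun k => ⟨hclose p hp q hq k, hclose q hq p hp k⟩, Or.inl hqi⟩
  · exact ⟨p.1, hsum p, fun k => ⟨Nat.le_add_right _ _, Nat.le_add_right _ _⟩,
      Or.inr (hnotin p hp i hi)⟩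

lemma stdSimplex.exists_apply_le (x y : stdSimplex ℝ ι) : ∃ i, x i ≤ y i := by
  by_contra! h
  have hne : (Finset.univ : Finset ι).Nonempty := by
    rw [Finset.nonempty_iff_ne_empty]
    intro h0
    have := stdSimplex.sum_eq_one x
    simp [h0] at this
  have := Finset.sum_lt_sum_of_nonempty hne fun i _ => h i
  rw [stdSimplex.sum_eq_one, stdSimplex.sum_eq_one] at this
  exact this.false

lemma stdSimplex.exists_approx_le_apply [Nonempty ι] (f : stdSimplex ℝ ι → stdSimplex ℝ ι)
    {ε : ℝ} (hε : 0 < ε) :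
    ∃ p : stdSimplex ℝ ι, ∀ i, ∃ q, dist p q ≤ ε ∧ q i ≤ f q i + ε := by
  obtain ⟨M, hM⟩ := exists_nat_gt (Fintype.card ι / ε)
  have hcard : (0 : ℝ) ≤ Fintype.card ι := Nat.cast_nonneg _
  have hMpos : (0 : ℝ) < M := (div_nonneg hcard hε.le).trans_lt hM
  have hMε : (Fintype.card ι : ℝ) / M ≤ ε := by
    rw [div_lt_iff₀ hε] at hM
    rw [div_le_iff₀ hMpos]
    linarith
  have hmem : ∀ t : ι → ℕ, ∑ k, t k = M → (fun k => (t k : ℝ) / M) ∈ stdSimplex ℝ ι := by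
    intro t ht
    refine ⟨fun k => by positivity, ?_⟩
    rw [← Finset.sum_div, ← Nat.cast_sum, ht, div_self hMpos.ne']
  have hcol : ∀ t : ι → ℕ, ∃ i, ∀ ht : ∑ k, t k = M,
      (⟨_, hmem t ht⟩ : stdSimplex ℝ ι) i ≤ f ⟨_, hmem t ht⟩ i := by
    intro t
    by_cases ht : ∑ k, t k = M
    · exact (stdSimplex.exists_apply_le ⟨_, hmem t ht⟩ (f ⟨_, hmem t ht⟩)).imp fun i hi _ => hi
    · exact ⟨Classical.arbitrary ι, fun h => absurd h ht⟩
  choose c hc using hcol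
  obtain ⟨p, hp, hpq⟩ := exists_nat_approx_of_coloring M c
  refine ⟨⟨_, hmem p hp⟩, fun i => ?_⟩
  obtain ⟨q, hq, hclose, hi⟩ := hpq i
  refine ⟨⟨_, hmem q hq⟩, ?_, ?_⟩
  · rw [Subtype.dist_eq, dist_pi_le_iff hε.le]
    intro k
    have h1 : (p k : ℝ) ≤ q k + Fintype.card ι := mod_cast (hclose k).1
    have h2 : (q k : ℝ) ≤ p k + Fintype.card ι := mod_cast (hclose k).2
    rw [Real.dist_eq, ← sub_div, abs_div, abs_of_pos hMpos]
    refine le_trans ?_ hMε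
    gcongr
    rw [abs_le]
    constructor <;> linarith
  · rcases hi with rfl | hi
    · exact (hc q hq).trans (le_add_of_nonneg_right hε.le)
    · have h1 : (q i : ℝ) / M ≤ Fintype.card ι / M := by
        gcongr
      have h2 := stdSimplex.zero_le (f ⟨_, hmem q hq⟩) i
      change (q i : ℝ) / M ≤ _
      linarith

/-- **Brouwer's fixed point theorem** for the standard simplex. -/
theorem stdSimplex.exists_isFixedPt [Nonempty ι] {f : stdSimplex ℝ ι → stdSimplex ℝ ι}
    (hf : Continuous f) : ∃ x, f x = x := by
  have hcoord : ∀ i, Continuous fun x : stdSimplex ℝ ι => x i := fun i =>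
    (continuous_apply i).comp continuous_subtype_val
  have happrox : ∀ ε > 0, ∃ p : stdSimplex ℝ ι, ∀ i, p i ≤ f p i + ε := by
    intro ε hε
    obtain ⟨δ, hδ, hfδ⟩ := Metric.uniformContinuous_iff.1
      (CompactSpace.uniformContinuous_of_continuous hf) (ε / 3) (by positivity)
    obtain ⟨p, hp⟩ := stdSimplex.exists_approx_le_apply f
      (show 0 < min (δ / 2) (ε / 3) by positivity)
    refine ⟨p, fun i => ?_⟩
    obtain ⟨q, hpq, hqi⟩ := hp i
    have h1 : dist (p i) (q i) ≤ dist p q := dist_le_pi_dist p.1 q.1 i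
    have h2 : dist (f p i) (f q i) ≤ dist (f p) (f q) := dist_le_pi_dist (f p).1 (f q).1 i
    have h3 := hfδ (show dist p q < δ by linarith [min_le_left (δ / 2) (ε / 3)])
    have h4 := min_le_right (δ / 2) (ε / 3)
    rw [Real.dist_eq] at h1 h2
    linarith [le_abs_self (p i - q i), neg_abs_le (f p i - f q i)]
  obtain ⟨x, -, hx⟩ := isCompact_univ.exists_isMinOn Set.univ_nonempty
    (f := fun x : stdSimplex ℝ ι => ∑ i, max (x i - f x i) 0)
    (continuous_finsetSum _ fun i _ =>
      (((hcoord i).sub ((hcoord i).comp hf)).max continuous_const)).continuousOn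
  have hzero : ∑ i, max (x i - f x i) 0 ≤ 0 := by
    refine le_of_forall_pos_le_add fun ε hε => ?_
    have hcard : (0 : ℝ) < Fintype.card ι := mod_cast Fintype.card_pos
    obtain ⟨p, hp⟩ := happrox (ε / Fintype.card ι) (by positivity)
    refine (hx (Set.mem_univ p)).trans ?_
    calc ∑ i, max (p i - f p i) 0 ≤ ∑ _i : ι, ε / Fintype.card ι :=
          Finset.sum_le_sum fun i _ => max_le (by linarith [hp i]) (by positivity)
      _ = 0 + ε := by
          rw [Finset.sum_const, Finset.card_univ, nsmul_eq_mul, zero_add]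
          field_simp
  have hle : ∀ i, x i ≤ f x i := by
    intro i
    have h1 := Finset.single_le_sum (f := fun i => max (x i - f x i) 0)
      (fun i _ => le_max_right _ _) (Finset.mem_univ i)
    have h2 := le_max_left (x i - f x i) 0
    linarith
  refine ⟨x, stdSimplex.ext (funext fun i => ?_)⟩
  exact ((Finset.sum_eq_sum_iff_of_le fun i _ => hle i).1
    (by rw [stdSimplex.sum_eq_one, stdSimplex.sum_eq_one]) i (Finset.mem_univ i)).symm

end Brouwer

/-- **Ky Fan's inequality**, for functions continuous in the first argument. -/
theorem IsCompact.exists_forall_le_zero_of_concaveOn {E : Type*} [AddCommGroup E] [Module ℝ E]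
    [TopologicalSpace E] [ContinuousAdd E] [ContinuousSMul ℝ E] {K : Set E} (hK : IsCompact K)
    (hne : K.Nonempty) (hconv : Convex ℝ K) {φ : E → E → ℝ}
    (hcont : ∀ y ∈ K, ContinuousOn (fun x => φ x y) K)
    (hconc : ∀ x ∈ K, ConcaveOn ℝ K (φ x)) (hdiag : ∀ x ∈ K, φ x x ≤ 0) :
    ∃ x ∈ K, ∀ y ∈ K, φ x y ≤ 0 := by
  by_contra! hpos
  choose! g hgK hg using hpos
  obtain ⟨t, htK, hcover⟩ := hK.elim_nhdsWithin_subcover (fun x => {z | 0 < φ z (g x)})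
    fun x hx => (hcont _ (hgK x hx) x hx).eventually_const_lt (hg x hx)
  have hcover' : ∀ z ∈ K, ∃ i : t, 0 < φ z (g i) := fun z hz => by
    obtain ⟨i, hi, hiz⟩ := Set.mem_iUnion₂.1 (hcover hz)
    exact ⟨⟨i, hi⟩, hiz⟩
  obtain ⟨z, hz⟩ := hne
  have : Nonempty t := (hcover' z hz).nonempty
  have hgt : ∀ i : t, g i ∈ K := fun i => hgK i (htK i i.2)
  set u : stdSimplex ℝ t → E := fun s => ∑ i, s i • g i
  have hcoord : ∀ i : t, Continuous fun s : stdSimplex ℝ t => s i := fun i =>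
    (continuous_apply i).comp continuous_subtype_val
  have hu : Continuous u := continuous_finsetSum _ fun i _ => (hcoord i).smul continuous_const
  have huK : ∀ s, u s ∈ K := fun s =>
    hconv.sum_mem (fun i _ => stdSimplex.zero_le s i) (stdSimplex.sum_eq_one s) fun i _ => hgt i
  set w : t → stdSimplex ℝ t → ℝ := fun i s => max (φ (u s) (g i)) 0
  have hw : ∀ i, Continuous (w i) := fun i =>
    ((hcont _ (hgt i)).comp_continuous hu huK).max continuous_const
  have hw0 : ∀ i s, 0 ≤ w i s := fun i s => le_max_right _ _
  have hW : ∀ s, 0 < ∑ i, w i s := fun s => by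
    obtain ⟨i, hi⟩ := hcover' _ (huK s)
    exact Finset.sum_pos' (fun i _ => hw0 i s) ⟨i, Finset.mem_univ i, lt_max_of_lt_left hi⟩
  obtain ⟨s, hs⟩ := stdSimplex.exists_isFixedPt
    (f := fun s => ⟨fun i => w i s / ∑ k, w k s, fun i => div_nonneg (hw0 i s) (hW s).le,
      by rw [← Finset.sum_div, div_self (hW s).ne']⟩)
    (Continuous.subtype_mk (continuous_pi fun i =>
      (hw i).div (continuous_finsetSum _ fun k _ => hw k) fun s => (hW s).ne') _)
  have hsw : ∀ i, s i = w i s / ∑ k, w k s := fun i =>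
    (DFunLike.congr_fun hs i).symm
  have hterm : ∀ i, 0 ≤ s i * φ (u s) (g i) := fun i => by
    rcases le_or_gt (φ (u s) (g i)) 0 with h | h
    · have : s i = 0 := by rw [hsw, show w i s = 0 from max_eq_right h, zero_div]
      rw [this, zero_mul]
    · exact mul_nonneg (stdSimplex.zero_le s i) h.le
  have hle : ∑ i, s i * φ (u s) (g i) ≤ φ (u s) (u s) :=
    (hconc _ (huK s)).le_map_sum (fun i _ => stdSimplex.zero_le s i) (stdSimplex.sum_eq_one s)
      fun i _ => hgt i
  obtain ⟨i, hi⟩ := hcover' _ (huK s)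
  have hsi : 0 < s i := by
    rw [hsw]
    exact div_pos (lt_max_of_lt_left hi) (hW s)
  have hsum : 0 < ∑ i, s i * φ (u s) (g i) :=
    Finset.sum_pos' (fun i _ => hterm i) ⟨i, Finset.mem_univ i, mul_pos hsi hi⟩
  linarith [hdiag _ (huK s)]

/-- existence of a Nash equilibrium for continuous payoffs that
are concave in the own decision variable, over nonempty convex compact
strategy sets in finite-dimensional spaces. -/
theorem nash_equilibrium_exists {n : ℕ} {E : Fin n → Type*}
    [∀ j, NormedAddCommGroup (E j)] [∀ j, NormedSpace ℝ (E j)]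
    [∀ j, FiniteDimensional ℝ (E j)]
    (X : ∀ j, Set (E j))
    (hne : ∀ j, (X j).Nonempty) (hconv : ∀ j, Convex ℝ (X j))
    (hcomp : ∀ j, IsCompact (X j))
    (ϑ : ∀ _j : Fin n, (∀ i, E i) → ℝ)
    (hcont : ∀ j, Continuous (ϑ j))
    (hconc : ∀ j (xs : ∀ i, E i),
      ConcaveOn ℝ (X j) (fun xj => ϑ j (Function.update xs j xj))) :
    ∃ xs : ∀ i, E i, (∀ i, xs i ∈ X i) ∧
      ∀ j, ∀ xj ∈ X j, ϑ j (Function.update xs j xj) ≤ ϑ j xs := by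
  obtain ⟨x, hx, hmax⟩ : ∃ x ∈ Set.univ.pi X, ∀ y ∈ Set.univ.pi X,
      ∑ j, (ϑ j (Function.update x j (y j)) - ϑ j x) ≤ 0 := by
    refine (isCompact_univ_pi hcomp).exists_forall_le_zero_of_concaveOn
      (Set.univ_pi_nonempty_iff.2 hne) (convex_pi fun j _ => hconv j) ?_ ?_ ?_
    · intro y _
      exact (continuous_finsetSum _ fun j _ => ((hcont j).comp
        (continuous_id.update j continuous_const)).sub (hcont j)).continuousOn
    · intro x _
      refine ⟨convex_pi fun j _ => hconv j, fun y hy z hz a b ha hb hab => ?_⟩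
      simp only [smul_eq_mul, Finset.mul_sum, ← Finset.sum_add_distrib]
      refine Finset.sum_le_sum fun j _ => ?_
      have hj := (hconc j x).2 (hy j (Set.mem_univ j)) (hz j (Set.mem_univ j)) ha hb hab
      simp only [smul_eq_mul] at hj
      simp only [Pi.add_apply, Pi.smul_apply]
      linear_combination hj - ϑ j x * hab
    · intro x _
      simp
  refine ⟨x, fun i => hx i (Set.mem_univ i), fun j xj hxj => ?_⟩
  have hy : Function.update x j xj ∈ Set.univ.pi X := by
    intro i _
    by_cases hij : i = j
    · subst hij
      simpa using hxj
    · simpa [hij] using hx i (Set.mem_univ i)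
  have hle := hmax _ hy
  rw [Finset.sum_eq_single j (fun k _ hkj => by simp [hkj]) (by simp)] at hle
  simpa using hle
end
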